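/- Let S be an absolutely irreducible cubic surface defined over F_q which is not a cone over a smooth absolutely irreducible plane cubic curve. Suppose that one of the following holds: (i) S has infinitely many singular points (non-isolated singularities); (ii) S has only finitely many singular points and at least one of them is F_q-rational; (iii) S has exactly two singular points. Then the number of F_q-rational points of S is at most q^2 + 7q + 1. -/

import Mathlib

noncomputable section

open MvPolynomial

variable (Fq : Type) [Field Fq] [Fintype Fq]

/-- `Kbar Fq` is a fixed algebraic closure of the finite field `Fq`. -/
abbrev Kbar : Type _ := AlgebraicClosure Fq

/-- The projective space `P^3` over the algebraic closure of `Fq`. -/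
abbrev P3 : Type _ := Projectivization (Kbar Fq) (Fin 4 → Kbar Fq)

variable {Fq}

/-- The zero locus in `P^3(K)` of a (homogeneous) polynomial. -/
def projZeros (F : MvPolynomial (Fin 4) (Kbar Fq)) : Set (P3 Fq) :=
  {p | eval p.rep F = 0}

/-- A point is singular for `F` if `F` and all four partial derivatives vanish there. -/
def IsSingularAt (F : MvPolynomial (Fin 4) (Kbar Fq)) (p : P3 Fq) : Prop :=
  eval p.rep F = 0 ∧ ∀ i, eval p.rep (pderiv i F) = 0

/-- A projective point is `F_q`-rational (`q = Fintype.card Fq`) if it has a representative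
all of whose coordinates lie in the subfield `F_q = {x | x ^ q = x}` of the closure. -/
def IsRatPoint (q : ℕ) (p : P3 Fq) : Prop :=
  ∃ (v : Fin 4 → Kbar Fq) (hv : v ≠ 0),
    Projectivization.mk (Kbar Fq) v hv = p ∧ ∀ i, v i ^ q = v i

/-- The projective line through two points (given via representatives). -/
def lineThrough (p r : P3 Fq) : Set (P3 Fq) :=
  {s | ∃ (a b : Kbar Fq) (h : a • p.rep + b • r.rep ≠ 0),
      s = Projectivization.mk (Kbar Fq) (a • p.rep + b • r.rep) h}

/-- `S = projZeros F` is a cone, with some vertex `P` not lying on a plane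
`H = {∑ cᵢ xᵢ = 0}`, over the plane curve `C = S ∩ H`, and `C` is a smooth absolutely
irreducible plane cubic: parametrizing `H` by an injective linear map given by the matrix
`M`, the pullback `G` of `F` is irreducible over the algebraic closure and has no
singular point. -/
def IsConeOverSmoothCubic (F : MvPolynomial (Fin 4) (Kbar Fq)) : Prop :=
  ∃ (P : P3 Fq) (c : Fin 4 → Kbar Fq) (M : Matrix (Fin 4) (Fin 3) (Kbar Fq)),
    c ≠ 0 ∧
    (∑ i, c i * P.rep i) ≠ 0 ∧
    Function.Injective M.mulVec ∧
    (∀ w : Fin 3 → Kbar Fq, ∑ i, c i * M.mulVec w i = 0) ∧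
    projZeros F =
      (⋃ Q ∈ projZeros F ∩ {x : P3 Fq | ∑ i, c i * x.rep i = 0}, lineThrough P Q) ∧
    Irreducible (aeval (fun i => ∑ j, C (M i j) * X j) F : MvPolynomial (Fin 3) (Kbar Fq)) ∧
    ∀ w : Fin 3 → Kbar Fq, w ≠ 0 →
      ¬(eval w (aeval (fun i => ∑ j, C (M i j) * X j) F :
            MvPolynomial (Fin 3) (Kbar Fq)) = 0 ∧
        ∀ k, eval w (pderiv k (aeval (fun i => ∑ j, C (M i j) * X j) F :
            MvPolynomial (Fin 3) (Kbar Fq))) = 0)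

section PA
variable {K : Type*} [Field K]

/-- Directional derivative. -/
def dd {n : ℕ} (F : MvPolynomial (Fin n) K) (v w : Fin n → K) : K :=
  ∑ i, w i * eval v (pderiv i F)

def HasTri {n : ℕ} (F : MvPolynomial (Fin n) K)
    (t : (Fin n → K) →ₗ[K] (Fin n → K) →ₗ[K] (Fin n → K) →ₗ[K] K) : Prop :=
  (∀ v, eval v F = t v v v) ∧ ∀ v w, dd F v w = t w v v + t v w v + t v v w

lemma exists_tri_monomial {n : ℕ} (i j k : Fin n) (a : K) :
    ∃ t, HasTri (C a * (X i * X j * X k) : MvPolynomial (Fin n) K) t := by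
  classical
  let p : Fin n → ((Fin n → K) →ₗ[K] K) := fun i => LinearMap.proj i
  let m : K →ₗ[K] K →ₗ[K] K := LinearMap.mul K K
  refine ⟨a • LinearMap.mk₂ K (fun u v => (u i * v j) • p k) ?_ ?_ ?_ ?_, ?_, ?_⟩
  · intro x y z; ext; simp [p]; ring
  · intro x y z; ext; simp [p]; ring
  · intro x y z; ext; simp [p]; ring
  · intro x y z; ext; simp [p]; ring
  · intro v; simp [p]
  · intro v w
    have h : ∀ l : Fin n, w l * eval v (pderiv l (C a * (X i * X j * X k) : MvPolynomial (Fin n) K))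
      = (if l = i then a * (w l * v j * v k) else 0) + (if l = j then a * (v i * w l * v k) else 0)
        + (if l = k then a * (v i * v j * w l) else 0) := by
      intro l
      simp only [Derivation.leibniz, pderiv_C, pderiv_X, smul_eq_mul, map_add, map_mul, eval_C,
        eval_X, Pi.single_apply]
      by_cases h1 : l = i <;> by_cases h2 : l = j <;> by_cases h3 : l = k <;>
        simp [h1, h2, h3, eq_comm] <;> simp_all [eq_comm] <;> ring
    unfold dd
    rw [Finset.sum_congr rfl (fun l _ => h l)]
    simp [Finset.sum_add_distrib, p]

lemma HasTri.add {n : ℕ} {F G : MvPolynomial (Fin n) K} {t s} (h : HasTri F t) (h' : HasTri G s) :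
    HasTri (F + G) (t + s) := by
  refine ⟨fun v => by simp [h.1, h'.1], fun v w => ?_⟩
  have : dd (F + G) v w = dd F v w + dd G v w := by
    simp [dd, mul_add, Finset.sum_add_distrib]
  rw [this, h.2, h'.2]; simp; ring

lemma exists_tri {n : ℕ} (F : MvPolynomial (Fin n) K) (h : F.IsHomogeneous 3) :
    ∃ t, HasTri F t := by
  classical
  have key : ∀ s : Finset (Fin n →₀ ℕ), s ⊆ F.support →
      ∃ t, HasTri (∑ d ∈ s, monomial d (coeff d F)) t := by
    intro s
    induction s using Finset.induction_on with
    | empty => intro _; exact ⟨0, by simp [HasTri, dd]⟩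
    | insert d s hd ih =>
      intro hs
      obtain ⟨t, ht⟩ := ih (fun x hx => hs (Finset.mem_insert_of_mem hx))
      rw [Finset.sum_insert hd]
      have hdeg : d.degree = 3 := by
        have := hs (Finset.mem_insert_self d s)
        by_contra hne
        exact (mem_support_iff.1 this) (h.coeff_eq_zero hne)
      obtain ⟨i, j, k, hd3⟩ : ∃ i j k : Fin n,
          d = Finsupp.single i 1 + Finsupp.single j 1 + Finsupp.single k 1 := by
        have hc : Multiset.card (Finsupp.toMultiset d) = 3 := by
          rw [Finsupp.card_toMultiset, ← hdeg]; rfl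
        obtain ⟨i, j, k, hm⟩ := Multiset.card_eq_three.1 hc
        refine ⟨i, j, k, ?_⟩
        have := congrArg Multiset.toFinsupp hm
        rw [Finsupp.toMultiset_toFinsupp] at this
        rw [this]
        change Multiset.toFinsupp ({i} + ({j} + {k})) = _
        rw [map_add, map_add]
        simp only [Multiset.toFinsupp_singleton, add_assoc]
      obtain ⟨t', ht'⟩ := exists_tri_monomial i j k (coeff d F)
      have : (monomial d (coeff d F) : MvPolynomial (Fin n) K)
          = C (coeff d F) * (X i * X j * X k) := by
        conv_lhs => rw [hd3]
        simp only [X, monomial_mul, C_mul_monomial]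
        simp [← hd3]
      rw [this]
      exact ⟨_, ht'.add ht⟩
  obtain ⟨t, ht⟩ := key F.support le_rfl
  rw [support_sum_monomial_coeff] at ht
  exact ⟨t, ht⟩

/-- substitution of linear forms -/
def lsub {m n : ℕ} (T : Matrix (Fin m) (Fin n) K) :
    MvPolynomial (Fin m) K →ₐ[K] MvPolynomial (Fin n) K :=
  aeval (fun i => ∑ j, C (T i j) * X j)

lemma eval_lsub {m n : ℕ} (T : Matrix (Fin m) (Fin n) K) (F : MvPolynomial (Fin m) K)
    (w : Fin n → K) : eval w (lsub T F) = eval (T.mulVec w) F := by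
  induction F using MvPolynomial.induction_on with
  | C a => simp [lsub]
  | add p q hp hq => simp [hp, hq]
  | mul_X p i hp => rw [map_mul, map_mul, map_mul, hp]; simp [lsub, Matrix.mulVec, dotProduct]

lemma lsub_homog {m n : ℕ} (T : Matrix (Fin m) (Fin n) K) {F : MvPolynomial (Fin m) K} {d : ℕ}
    (h : F.IsHomogeneous d) : (lsub T F).IsHomogeneous d := by
  have := h.aeval (fun i => ∑ j, C (T i j) * X j : Fin m → MvPolynomial (Fin n) K) (n := 1)
    (fun i => IsHomogeneous.sum _ _ _ (fun j _ => isHomogeneous_C_mul_X _ _))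
  simpa [lsub] using this

lemma irr_transfer {R S : Type*} [CommRing R] [CommRing S] (ψ : R →+* S) (φ : S →+* R) (F : R)
    (hF : Irreducible F) (h1 : φ (ψ F) = F) (h2 : ∀ a, ψ (φ a) = a) : Irreducible (ψ F) := by
  refine ⟨fun hu => hF.not_isUnit (h1 ▸ hu.map φ), fun a b hab => ?_⟩
  have : F = φ a * φ b := by rw [← map_mul, ← hab, h1]
  rcases hF.isUnit_or_isUnit this with h | h
  · left; simpa [h2] using h.map ψ
  · right; simpa [h2] using h.map ψ

lemma exists_extend_cons {m n : ℕ} (v : Fin m → (Fin n → K)) (hv : LinearIndependent K v) (h : m < n) :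
    ∃ x, LinearIndependent K (Fin.cons x v : Fin (m+1) → (Fin n → K)) ∧
      x ∉ Submodule.span K (Set.range v) := by
  have : Submodule.span K (Set.range v) ≠ ⊤ := by
    intro ht
    have h1 := finrank_span_eq_card hv
    rw [ht] at h1
    simp at h1; omega
  obtain ⟨x, hx⟩ := SetLike.exists_not_mem_of_ne_top _ this rfl
  exact ⟨x, linearIndependent_finCons.2 ⟨hv, hx⟩, hx⟩

variable [Infinite K]

lemma lsub_irr {n : ℕ} (e : (Fin n → K) ≃ₗ[K] (Fin n → K)) {F : MvPolynomial (Fin n) K}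
    (hF : Irreducible F) : Irreducible (lsub (LinearMap.toMatrix' (e : (Fin n → K) →ₗ[K] (Fin n → K))) F) := by
  refine irr_transfer (lsub (LinearMap.toMatrix' (e : (Fin n → K) →ₗ[K] (Fin n → K)))).toRingHom
    (lsub (LinearMap.toMatrix' (e.symm : (Fin n → K) →ₗ[K] (Fin n → K)))).toRingHom F hF ?_ ?_
  · apply MvPolynomial.funext; intro x
    simp [eval_lsub, LinearMap.toMatrix'_mulVec]
  · intro a; apply MvPolynomial.funext; intro x
    simp [eval_lsub, LinearMap.toMatrix'_mulVec]

lemma no_plane {F : MvPolynomial (Fin 4) K} (hF : Irreducible F) (hh : F.IsHomogeneous 3)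
    {v₁ v₂ v₃ : Fin 4 → K} (hl : LinearIndependent K ![v₁, v₂, v₃])
    (h : ∀ a b c : K, eval (a • v₁ + b • v₂ + c • v₃) F = 0) : False := by
  obtain ⟨x, hx, -⟩ := exists_extend_cons _ hl (by norm_num)
  let B := basisOfLinearIndependentOfCardEqFinrank hx (by simp)
  let e := B.equivFun.symm
  have he : ∀ w, e w = w 0 • x + w 1 • v₁ + w 2 • v₂ + w 3 • v₃ := by
    intro w
    simp only [e, Module.Basis.equivFun_symm_apply, B, coe_basisOfLinearIndependentOfCardEqFinrank]
    rw [Fin.sum_univ_four]; rfl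
  have hirr := lsub_irr e hF
  have hhom := lsub_homog (LinearMap.toMatrix' (e : (Fin 4 → K) →ₗ[K] (Fin 4 → K))) hh
  have hev : ∀ w, eval w (lsub (LinearMap.toMatrix' (e : (Fin 4 → K) →ₗ[K] (Fin 4 → K))) F)
    = eval (e w) F := by intro w; rw [eval_lsub, LinearMap.toMatrix'_mulVec]; rfl
  set G := lsub (LinearMap.toMatrix' (e : (Fin 4 → K) →ₗ[K] (Fin 4 → K))) F
  have h0 : (finSuccEquiv K 3 G).coeff 0 = 0 := by
    apply MvPolynomial.funext; intro u
    have := eval_eq_eval_mv_eval' u 0 G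
    rw [hev, he] at this
    rw [← Polynomial.coeff_zero_eq_eval_zero, Polynomial.coeff_map] at this
    rw [← this]
    simpa using h _ _ _
  have hd : (X 0 : MvPolynomial (Fin 4) K) ∣ G := by
    have := Polynomial.X_dvd_iff.2 h0
    rw [← finSuccEquiv_X_zero] at this
    exact (map_dvd_iff (finSuccEquiv K 3)).1 this
  obtain ⟨g, hg⟩ := hd
  have hX : ¬ IsUnit (X 0 : MvPolynomial (Fin 4) K) := by
    intro hu
    have := hu.map (eval (0 : Fin 4 → K))
    simp at this
  rcases hirr.isUnit_or_isUnit hg with h1 | h1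
  · exact hX h1
  · rw [MvPolynomial.isUnit_iff_eq_C_of_isReduced] at h1
    obtain ⟨r, hr, rfl⟩ := h1
    have h3 : G.IsHomogeneous 1 := by
      rw [hg, mul_comm]; exact isHomogeneous_C_mul_X _ _
    have := hhom.inj_right h3 hirr.ne_zero
    omega

end PA

section PB
variable {K : Type*} [Field K]

lemma finrank_homog (d : ℕ) :
    Module.finrank K (homogeneousSubmodule (Fin 3) K d) = (Finset.finsuppAntidiag (Finset.univ : Finset (Fin 3)) d).card
    ∧ FiniteDimensional K (homogeneousSubmodule (Fin 3) K d) := by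
  classical
  have hset : {s : Fin 3 →₀ ℕ | s.degree = d} = ↑(Finset.finsuppAntidiag (Finset.univ : Finset (Fin 3)) d) := by
    ext s
    simp [Finset.mem_finsuppAntidiag, Finsupp.degree_eq_sum]
  have e : homogeneousSubmodule (Fin 3) K d ≃ₗ[K]
      ((Finset.finsuppAntidiag (Finset.univ : Finset (Fin 3)) d) →₀ K) := by
    rw [homogeneousSubmodule_eq_finsupp_supported, hset]
    exact AddMonoidAlgebra.supportedEquivFinsupp _
  constructor
  · rw [e.finrank_eq]; simp
  · exact Module.Finite.equiv e.symm

lemma exists_linear_form {u w : Fin 3 → K} (h : LinearIndependent K ![u, w]) :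
    ∃ l : MvPolynomial (Fin 3) K, l.IsHomogeneous 1 ∧ eval u l = 0 ∧ eval w l ≠ 0 := by
  have hw : w ∉ Submodule.span K {u} := by
    intro hw
    obtain ⟨a, ha⟩ := Submodule.mem_span_singleton.1 hw
    have := LinearIndependent.pair_iff.1 h a (-1) (by simp [ha])
    simpa using this.2
  obtain ⟨f, hf1, hf2⟩ := Submodule.exists_le_ker_of_notMem hw
  have hl : ∀ x, eval x (∑ i, C (f (Pi.single i 1)) * X i : MvPolynomial (Fin 3) K) = f x := by
    intro x
    rw [f.pi_apply_eq_sum_univ x]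
    simp [map_sum]
    refine Finset.sum_congr rfl fun i _ => ?_
    rw [mul_comm]; congr 2; ext j; simp [Pi.single_apply, eq_comm]
  refine ⟨∑ i, C (f (Pi.single i 1)) * X i, IsHomogeneous.sum _ _ _ (fun i _ => isHomogeneous_C_mul_X (f (Pi.single i 1)) i), ?_, ?_⟩
  · rw [hl]; exact hf2 (Submodule.mem_span_singleton_self u)
  · rw [hl]; exact hf1

lemma bezout {A B : MvPolynomial (Fin 3) K} (hA : A.IsHomogeneous 2) (hB : B.IsHomogeneous 3)
    (hA0 : A ≠ 0) (hAB : IsRelPrime A B) (u : Fin 7 → (Fin 3 → K))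
    (hu : ∀ i, eval (u i) A = 0 ∧ eval (u i) B = 0) :
    ∃ i j, i ≠ j ∧ ¬ LinearIndependent K ![u i, u j] := by
  classical
  by_contra hcon
  push Not at hcon
  let P := fun d => homogeneousSubmodule (Fin 3) K d
  have := fun d => (finrank_homog (K := K) d).2
  -- the multiplication map
  let Φ : (P 4 × P 3) →ₗ[K] P 6 :=
    { toFun := fun g => ⟨g.1.1 * A + g.2.1 * B,
        IsHomogeneous.add (IsHomogeneous.mul g.1.2 hA) (IsHomogeneous.mul g.2.2 hB)⟩
      map_add' := by intro x y; ext1; simp; ring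
      map_smul' := by intro c x; ext1; simp }
  let Ψ : P 1 →ₗ[K] (P 4 × P 3) :=
    { toFun := fun l => (⟨-(l.1 * B), (IsHomogeneous.mul l.2 hB).neg⟩, ⟨l.1 * A, IsHomogeneous.mul l.2 hA⟩)
      map_add' := by intro x y; ext1 <;> ext1 <;> simp <;> ring
      map_smul' := by intro c x; ext1 <;> ext1 <;> simp }
  let E : P 6 →ₗ[K] (Fin 7 → K) :=
    { toFun := fun g i => eval (u i) g.1
      map_add' := by intro x y; ext i; simp
      map_smul' := by intro c x; ext i; simp [smul_eval] }
  have hker : LinearMap.ker Φ ≤ LinearMap.range Ψ := by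
    rintro ⟨⟨g, hg⟩, ⟨h, hh⟩⟩ hgh
    have h0 : g * A + h * B = 0 := by
      have := congrArg Subtype.val (LinearMap.mem_ker.1 hgh)
      simpa [Φ] using this
    have hdvd : A ∣ h := by
      apply hAB.dvd_of_dvd_mul_right
      exact ⟨-g, by linear_combination h0⟩
    obtain ⟨l, hl⟩ := hdvd
    have hl1 : h = A * homogeneousComponent 1 l := by
      have h1 := homogeneousComponent_eq_self hh
      rw [hl] at h1
      conv_lhs at h1 => rw [← sum_homogeneousComponent l, Finset.mul_sum, map_sum]
      rw [hl, ← h1]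
      have : ∀ i ∈ Finset.range (l.totalDegree + 1),
          homogeneousComponent 3 (A * homogeneousComponent i l) =
            if i = 1 then A * homogeneousComponent 1 l else 0 := by
        intro i _
        rw [homogeneousComponent_of_mem (n := 2 + i)
          (IsHomogeneous.mul hA (homogeneousComponent_isHomogeneous i l))]
        by_cases hi : i = 1
        · simp [hi]
        · rw [if_neg (by omega), if_neg hi]
      rw [Finset.sum_congr rfl this, Finset.sum_ite_eq']
      split_ifs with hm
      · rfl
      · rw [homogeneousComponent_eq_zero 1 l (by simp at hm; omega)]; simp
    refine ⟨⟨homogeneousComponent 1 l, homogeneousComponent_isHomogeneous _ _⟩, ?_⟩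
    have hg' : g = -(homogeneousComponent 1 l * B) := by
      have : (g + homogeneousComponent 1 l * B) * A = 0 := by
        rw [hl1] at h0; linear_combination h0
      rcases mul_eq_zero.1 this with h2 | h2
      · linear_combination h2
      · exact absurd h2 hA0
    ext1 <;> ext1
    · simp [Ψ, hg']
    · simp only [Ψ]; rw [hl1]; simp [mul_comm]
  have hE : Function.Surjective E := by
    rw [← LinearMap.range_eq_top, eq_top_iff, ← (Pi.basisFun K (Fin 7)).span_eq, Submodule.span_le]
    rintro _ ⟨i, rfl⟩
    have hex : ∀ j, j ≠ i → ∃ l : MvPolynomial (Fin 3) K, l.IsHomogeneous 1 ∧ eval (u j) l = 0 ∧ eval (u i) l ≠ 0 :=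
      fun j hj => exists_linear_form (hcon j i hj)
    choose! l hl1 hl2 hl3 using hex
    have hh : (∏ j ∈ Finset.univ.erase i, l j).IsHomogeneous 6 := by
      have := IsHomogeneous.prod (Finset.univ.erase i) l (fun _ => 1) (fun j hj => hl1 j (Finset.ne_of_mem_erase hj))
      simpa using this
    have hne : eval (u i) (∏ j ∈ Finset.univ.erase i, l j) ≠ 0 := by
      rw [map_prod]
      exact Finset.prod_ne_zero_iff.2 fun j hj => hl3 j (Finset.ne_of_mem_erase hj)
    refine ⟨(eval (u i) (∏ j ∈ Finset.univ.erase i, l j))⁻¹ • ⟨_, hh⟩, ?_⟩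
    ext j
    by_cases hj : j = i
    · subst hj
      simp only [E, LinearMap.coe_mk, AddHom.coe_mk, Submodule.coe_smul, smul_eval]
      rw [inv_mul_cancel₀ hne]; simp
    · have : eval (u j) (∏ j ∈ Finset.univ.erase i, l j) = 0 := by
        rw [map_prod]
        exact Finset.prod_eq_zero (Finset.mem_erase.2 ⟨hj, Finset.mem_univ j⟩) (hl2 j hj)
      simp only [E, LinearMap.coe_mk, AddHom.coe_mk, Submodule.coe_smul, smul_eval]
      rw [this]; simp [hj]
  have hle : LinearMap.range Φ ≤ LinearMap.ker E := by
    rintro _ ⟨g, rfl⟩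
    rw [LinearMap.mem_ker]; ext i
    simp [E, Φ, (hu i).1, (hu i).2]
  have r1 := LinearMap.finrank_range_add_finrank_ker Φ
  have r2 := LinearMap.finrank_range_add_finrank_ker E
  have r3 := Submodule.finrank_mono hle
  have r4 := (Submodule.finrank_mono hker).trans (LinearMap.finrank_range_le Ψ)
  rw [LinearMap.range_eq_top.2 hE, finrank_top] at r2
  rw [Module.finrank_prod] at r1
  simp only [Module.finrank_fin_fun] at r2
  have c1 : Module.finrank K (P 1) = 3 := by rw [(finrank_homog 1).1]; decide
  have c3 : Module.finrank K (P 3) = 10 := by rw [(finrank_homog 3).1]; decide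
  have c4 : Module.finrank K (P 4) = 15 := by rw [(finrank_homog 4).1]; decide
  have c6 : Module.finrank K (P 6) = 28 := by rw [(finrank_homog 6).1]; decide
  omega
end PB

section PC
variable {K : Type*} [Field K] {n : ℕ}

def SingV (F : MvPolynomial (Fin n) K) (v : Fin n → K) : Prop :=
  eval v F = 0 ∧ ∀ w, dd F v w = 0

def TripV (F : MvPolynomial (Fin n) K) (v : Fin n → K) : Prop :=
  SingV F v ∧ ∀ w, dd F w v = 0

def bb (F : MvPolynomial (Fin n) K) (u v w : Fin n → K) : K :=
  dd F (u + v) w - dd F u w - dd F v w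

lemma ev_add {F : MvPolynomial (Fin n) K} (hh : F.IsHomogeneous 3) (a b : K) (v x : Fin n → K) :
    eval (a • v + b • x) F =
      a ^ 3 * eval v F + a ^ 2 * b * dd F v x + a * b ^ 2 * dd F x v + b ^ 3 * eval x F := by
  obtain ⟨t, h1, h2⟩ := exists_tri F hh
  simp only [h1, h2, map_add, map_smul, LinearMap.add_apply, LinearMap.smul_apply, smul_eq_mul]
  ring

lemma ev_smul {F : MvPolynomial (Fin n) K} (hh : F.IsHomogeneous 3) (a : K) (v : Fin n → K) :
    eval (a • v) F = a ^ 3 * eval v F := by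
  have := ev_add hh a 0 v 0
  simpa using this

lemma dd_add {F : MvPolynomial (Fin n) K} (hh : F.IsHomogeneous 3) (a b : K) (v x w : Fin n → K) :
    dd F (a • v + b • x) w = a ^ 2 * dd F v w + a * b * bb F v x w + b ^ 2 * dd F x w := by
  obtain ⟨t, h1, h2⟩ := exists_tri F hh
  simp only [bb, h2, map_add, map_smul, LinearMap.add_apply, LinearMap.smul_apply, smul_eq_mul]
  ring

lemma dd_smul {F : MvPolynomial (Fin n) K} (hh : F.IsHomogeneous 3) (a : K) (v w : Fin n → K) :
    dd F (a • v) w = a ^ 2 * dd F v w := by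
  have := dd_add hh a 0 v 0 w
  simpa using this

lemma dd_self {F : MvPolynomial (Fin n) K} (hh : F.IsHomogeneous 3) (a : K) (v x : Fin n → K) :
    dd F (a • v + x) v = a ^ 2 * (3 * eval v F) + 2 * a * dd F v x + dd F x v := by
  obtain ⟨t, h1, h2⟩ := exists_tri F hh
  simp only [h1, h2, map_add, map_smul, LinearMap.add_apply, LinearMap.smul_apply, smul_eq_mul]
  ring

lemma bb_symm {F : MvPolynomial (Fin n) K} (hh : F.IsHomogeneous 3) (u v w : Fin n → K) :
    bb F u v w = bb F v w u := by
  obtain ⟨t, h1, h2⟩ := exists_tri F hh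
  simp only [bb, h2, map_add, LinearMap.add_apply]
  ring

lemma ev_three {F : MvPolynomial (Fin n) K} (hh : F.IsHomogeneous 3) (a b c : K)
    {r s : Fin n → K} (hr : SingV F r) (hs : SingV F s) (u : Fin n → K) :
    eval (c • u + a • r + b • s) F = c ^ 3 * eval u F + a * (c ^ 2 * dd F u r) +
      b * (c ^ 2 * dd F u s) + a * b * (c * bb F u r s) := by
  have h1 := hr.1
  have h2 := hs.1
  have h3 := hr.2 u
  have h4 := hr.2 s
  have h5 := hs.2 u
  have h6 := hs.2 r
  obtain ⟨t, e1, e2⟩ := exists_tri F hh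
  simp only [bb, e1, e2, map_add, map_smul, LinearMap.add_apply, LinearMap.smul_apply, smul_eq_mul] at *
  linear_combination a ^ 3 * h1 + b ^ 3 * h2 + a ^ 2 * c * h3 + a ^ 2 * b * h4 + b ^ 2 * c * h5 + b ^ 2 * a * h6

lemma SingV.smul {F : MvPolynomial (Fin n) K} (hh : F.IsHomogeneous 3) {v : Fin n → K}
    (h : SingV F v) (a : K) : SingV F (a • v) :=
  ⟨by rw [ev_smul hh, h.1, mul_zero], fun w => by rw [dd_smul hh, h.2, mul_zero]⟩

lemma line_of_bb {F : MvPolynomial (Fin n) K} (hh : F.IsHomogeneous 3) {v s : Fin n → K}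
    (hv : SingV F v) (hs : SingV F s) (h : ∀ w, bb F v s w = 0) (a b : K) :
    SingV F (a • v + b • s) :=
  ⟨by rw [ev_add hh, hv.1, hs.1, hv.2, hs.2]; ring,
   fun w => by rw [dd_add hh, hv.2, hs.2, h]; ring⟩

lemma line_of_trip {F : MvPolynomial (Fin n) K} (hh : F.IsHomogeneous 3) {v s : Fin n → K}
    (hv : TripV F v) (hs : SingV F s) (a b : K) : SingV F (a • v + b • s) := by
  refine line_of_bb hh hv.1 hs (fun w => ?_) a b
  rw [bb_symm hh]; simp [bb, hv.2]

lemma line_of_three {F : MvPolynomial (Fin n) K} (hh : F.IsHomogeneous 3) {v s : Fin n → K}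
    (hv : SingV F v) (hs : SingV F s) {c d : K} (hc : c ≠ 0) (hd : d ≠ 0)
    (h : SingV F (c • v + d • s)) (a b : K) : SingV F (a • v + b • s) := by
  refine line_of_bb hh hv hs (fun w => ?_) a b
  have := h.2 w
  rw [dd_add hh, hv.2, hs.2] at this
  simpa [hc, hd] using this

lemma binary_zero [IsAlgClosed K] {F : MvPolynomial (Fin n) K} (hh : F.IsHomogeneous 3) (u v : Fin n → K) :
    ∃ a b : K, (a ≠ 0 ∨ b ≠ 0) ∧ eval (a • u + b • v) F = 0 := by
  by_cases h : eval u F = 0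
  · exact ⟨1, 0, by simp, by simp [h]⟩
  · let p : Polynomial K := Polynomial.C (eval u F) * Polynomial.X ^ 3 + Polynomial.C (dd F u v) * Polynomial.X ^ 2
      + Polynomial.C (dd F v u) * Polynomial.X + Polynomial.C (eval v F)
    have hp : p.degree = 3 := Polynomial.degree_cubic h
    obtain ⟨x, hx⟩ := IsAlgClosed.exists_root p (by rw [hp]; decide)
    refine ⟨x, 1, by simp, ?_⟩
    rw [ev_add hh]
    simp [p, Polynomial.IsRoot] at hx
    linear_combination hx

variable [Infinite K]

/-- all singular points lie on a singular line -/
lemma mem_line {F : MvPolynomial (Fin 4) K} (hF : Irreducible F) (hh : F.IsHomogeneous 3)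
    {v₁ v₂ v : Fin 4 → K} (hl : LinearIndependent K ![v₁, v₂])
    (h : ∀ a b : K, SingV F (a • v₁ + b • v₂)) (hv : SingV F v) :
    ∃ a b : K, v = a • v₁ + b • v₂ := by
  by_contra hcon
  have hx : v ∉ Submodule.span K (Set.range ![v₁, v₂]) := by
    intro hm
    rw [Matrix.range_cons, Matrix.range_cons, Matrix.range_empty, Set.union_empty,
      Set.singleton_union, Submodule.mem_span_pair] at hm
    obtain ⟨a, b, hab⟩ := hm
    exact hcon ⟨a, b, hab.symm⟩
  have h3 : LinearIndependent K ![v, v₁, v₂] := linearIndependent_finCons.2 ⟨hl, hx⟩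
  refine no_plane hF hh h3 fun a b c => ?_
  have := ev_add hh a 1 v (b • v₁ + c • v₂)
  rw [one_smul, ← add_assoc, hv.1, hv.2, (h b c).1, (h b c).2] at this
  rw [this]; ring

lemma double_pt {F : MvPolynomial (Fin 4) K} (hF : Irreducible F) (hh : F.IsHomogeneous 3)
    {v : Fin 4 → K} (hv : v ≠ 0) (hs : SingV F v) (hd : ∃ w, dd F w v ≠ 0)
    (s : Fin 7 → Fin 4 → K) (h : ∀ j, eval (s j) F = 0 ∧ dd F (s j) v = 0) :
    ∃ i j, i ≠ j ∧ ¬ LinearIndependent K ![v, s i, s j] := by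
  have hl0 : LinearIndependent K ![v] := by
    rw [linearIndependent_unique_iff]; simpa using hv
  obtain ⟨z, hz, -⟩ := exists_extend_cons _ hl0 (by norm_num)
  obtain ⟨y, hy, -⟩ := exists_extend_cons _ hz (by norm_num)
  obtain ⟨x, hx, -⟩ := exists_extend_cons _ hy (by norm_num)
  have hx' := hx.comp Fin.rev Fin.rev_injective
  let B := basisOfLinearIndependentOfCardEqFinrank hx' (by simp)
  let e := B.equivFun.symm
  have he : ∀ w, e w = w 0 • v + w 1 • z + w 2 • y + w 3 • x := by
    intro w
    simp only [e, Module.Basis.equivFun_symm_apply, B, coe_basisOfLinearIndependentOfCardEqFinrank]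
    rw [Fin.sum_univ_four]; rfl
  have hirr := lsub_irr e hF
  have hhom := lsub_homog (LinearMap.toMatrix' (e : (Fin 4 → K) →ₗ[K] (Fin 4 → K))) hh
  have hev : ∀ w, eval w (lsub (LinearMap.toMatrix' (e : (Fin 4 → K) →ₗ[K] (Fin 4 → K))) F)
    = eval (e w) F := by intro w; rw [eval_lsub, LinearMap.toMatrix'_mulVec]; rfl
  set G := lsub (LinearMap.toMatrix' (e : (Fin 4 → K) →ₗ[K] (Fin 4 → K))) F
  let m : (Fin 3 → K) → (Fin 4 → K) := fun u => u 0 • z + u 1 • y + u 2 • x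
  have hm : ∀ (a : K) (u : Fin 3 → K), e (Fin.cons a u) = a • v + m u := by
    intro a u
    rw [he, add_assoc, add_assoc]
    simp only [m, add_assoc]; rfl
  let p := finSuccEquiv K 3 G
  have hpu : ∀ u, Polynomial.map (eval u) p =
      Polynomial.C (dd F (m u) v) * Polynomial.X + Polynomial.C (eval (m u) F) := by
    intro u
    apply Polynomial.funext; intro a
    rw [← eval_eq_eval_mv_eval', hev, hm]
    have := ev_add hh a 1 v (m u)
    rw [one_smul, hs.1, hs.2] at this
    rw [this]; simp; ring
  have hc : ∀ u k, eval u (p.coeff k) = (Polynomial.C (dd F (m u) v) * Polynomial.X + Polynomial.C (eval (m u) F)).coeff k := by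
    intro u k; rw [← hpu, Polynomial.coeff_map]
  have hc1 : ∀ u, eval u (p.coeff 1) = dd F (m u) v := by
    intro u; rw [hc]; simp [Polynomial.coeff_C]
  have hc0 : ∀ u, eval u (p.coeff 0) = eval (m u) F := by
    intro u; rw [hc]; simp
  have hp : p = Polynomial.C (p.coeff 1) * Polynomial.X + Polynomial.C (p.coeff 0) := by
    ext1 k
    rcases k with _ | _ | k
    · simp
    · simp [Polynomial.coeff_C]
    · have : p.coeff (k+2) = 0 := by
        apply MvPolynomial.funext; intro u
        rw [hc]; simp [Polynomial.coeff_C]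
      rw [this]; simp [Polynomial.coeff_C, Polynomial.coeff_X]
  have hne : p.coeff 1 ≠ 0 := by
    intro h0
    obtain ⟨w, hw⟩ := hd
    apply hw
    have h1 : w = (e.symm w) 0 • v + m (Fin.tail (e.symm w)) := by
      rw [← hm, Fin.cons_self_tail]; simp
    rw [h1, dd_self hh, hs.1, hs.2, ← hc1, h0]; simp
  have hpirr : Irreducible p := (MulEquiv.irreducible_iff (finSuccEquiv K 3)).2 hirr
  have hrel : IsRelPrime (p.coeff 1) (p.coeff 0) := by
    rintro d ⟨a, ha⟩ ⟨b, hb⟩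
    have : p = Polynomial.C d * (Polynomial.C a * Polynomial.X + Polynomial.C b) := by
      rw [hp, ha, hb]; simp; ring
    rcases hpirr.isUnit_or_isUnit this with h1 | h1
    · exact Polynomial.isUnit_C.1 h1
    · exfalso
      have h2 := Polynomial.natDegree_eq_zero_of_isUnit h1
      have h3 : a = 0 := by
        have := Polynomial.coeff_eq_zero_of_natDegree_lt (p := Polynomial.C a * Polynomial.X + Polynomial.C b) (n := 1) (by omega)
        simpa [Polynomial.coeff_C] using this
      rw [h3, mul_zero] at ha
      exact hne ha
  have hA : (p.coeff 1).IsHomogeneous 2 := hhom.finSuccEquiv_coeff_isHomogeneous 1 2 rfl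
  have hB : (p.coeff 0).IsHomogeneous 3 := hhom.finSuccEquiv_coeff_isHomogeneous 0 3 rfl
  have hsj : ∀ j, s j = (e.symm (s j)) 0 • v + m (Fin.tail (e.symm (s j))) := by
    intro j; rw [← hm, Fin.cons_self_tail]; simp
  have hz : ∀ j, eval (Fin.tail (e.symm (s j))) (p.coeff 1) = 0 := by
    intro j
    have := (h j).2
    rw [hsj j, dd_self hh, hs.1, hs.2, ← hc1] at this
    simpa using this
  obtain ⟨i, j, hij, hdep⟩ := bezout hA hB hne hrel (fun j => Fin.tail (e.symm (s j))) (fun j => by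
    refine ⟨hz j, ?_⟩
    have h1 := (h j).1
    have := ev_add hh ((e.symm (s j)) 0) 1 v (m (Fin.tail (e.symm (s j))))
    rw [one_smul, ← hsj j, h1, hs.1, hs.2, ← hc1, ← hc0, hz j] at this
    simpa using this.symm)
  refine ⟨i, j, hij, fun hli => hdep ?_⟩
  rw [LinearIndependent.pair_iff]
  intro α β hab
  rw [Fintype.linearIndependent_iff] at hli
  have key : α • m (Fin.tail (e.symm (s i))) + β • m (Fin.tail (e.symm (s j))) = 0 := by
    have hmm : ∀ u w, α • m u + β • m w = m (α • u + β • w) := by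
      intro u w
      simp only [m, Pi.add_apply, Pi.smul_apply, smul_eq_mul]
      module
    rw [hmm, hab]; simp [m]
  have := hli ![-(α * (e.symm (s i)) 0 + β * (e.symm (s j)) 0), α, β] (by
    simp only [Fin.sum_univ_three, Matrix.cons_val]
    set a := (e.symm (s i)) 0
    set b := (e.symm (s j)) 0
    rw [hsj i, hsj j]
    rw [← key]
    module)
  exact ⟨this 1, this 2⟩

lemma two_trip [IsAlgClosed K] {F : MvPolynomial (Fin 4) K} (hF : Irreducible F) (hh : F.IsHomogeneous 3)
    {v₁ v₂ : Fin 4 → K} (hl : LinearIndependent K ![v₁, v₂]) (h1 : TripV F v₁) (h2 : TripV F v₂) :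
    False := by
  obtain ⟨x, hx, -⟩ := exists_extend_cons _ hl (by norm_num)
  obtain ⟨y, hy, -⟩ := exists_extend_cons _ hx (by norm_num)
  obtain ⟨a, b, hab, h0⟩ := binary_zero hh x y
  have hl3 : LinearIndependent K ![a • x + b • y, v₁, v₂] := by
    rw [Fintype.linearIndependent_iff] at hy ⊢
    intro g hg
    have := hy ![g 0 * b, g 0 * a, g 1, g 2] (by
      rw [← hg]
      refine (Fin.sum_univ_four _).trans ?_
      simp only [Fin.sum_univ_three, Matrix.cons_val]
      change (g 0 * b) • y + (g 0 * a) • x + g 1 • v₁ + g 2 • v₂ = _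
      module)
    have e0 := this 0
    have e1 := this 1
    have e2 := this 2
    have e3 := this 3
    simp at e0 e1 e2 e3
    intro i; fin_cases i
    · change g 0 = 0; tauto
    · exact e2
    · exact e3
  refine no_plane hF hh hl3 fun c d f => ?_
  rw [ev_three hh d f c h1.1 h2.1, h0, h1.2, h2.2]
  have : bb F (a • x + b • y) v₁ v₂ = 0 := by simp [bb, h2.2]
  rw [this]; ring
end PC

section PD
variable {K : Type*} [Field K] {n : ℕ}

lemma singV_iff (F : MvPolynomial (Fin n) K) (v : Fin n → K) :
    SingV F v ↔ eval v F = 0 ∧ ∀ i, eval v (pderiv i F) = 0 := by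
  classical
  constructor
  · rintro ⟨h1, h2⟩
    refine ⟨h1, fun i => ?_⟩
    have := h2 (Pi.single i 1)
    simpa [dd, Pi.single_apply] using this
  · rintro ⟨h1, h2⟩
    exact ⟨h1, fun w => by simp [dd, h2]⟩

lemma eval_frob (φ : K →+* K) {F : MvPolynomial (Fin n) K} (hF : map φ F = F) (v : Fin n → K) :
    eval (φ ∘ v) F = φ (eval v F) := by
  conv_lhs => rw [← hF]
  rw [eval_map]
  exact (eval₂_comp_left φ (RingHom.id K) v F).symm

lemma sing_frob (φ : K →+* K) {F : MvPolynomial (Fin n) K} (hF : map φ F = F) {v : Fin n → K}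
    (h : SingV F v) : SingV F (φ ∘ v) := by
  rw [singV_iff] at h ⊢
  refine ⟨by rw [eval_frob φ hF, h.1, map_zero], fun i => ?_⟩
  rw [eval_frob φ (by rw [← pderiv_map, hF]), h.2, map_zero]

lemma rational_on_line [Infinite K] (φ : K →+* K) {F : MvPolynomial (Fin 4) K} (hφ : map φ F = F)
    (hF : Irreducible F) (hh : F.IsHomogeneous 3)
    {v₁ v₂ : Fin 4 → K} (hl : LinearIndependent K ![v₁, v₂])
    (h : ∀ a b : K, SingV F (a • v₁ + b • v₂)) (i : Fin 4) (hi : v₁ i ≠ 0 ∨ v₂ i ≠ 0) :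
    ∃ s : Fin 4 → K, s ≠ 0 ∧ SingV F s ∧ φ ∘ s = s ∧ s i = 0 := by
  rw [LinearIndependent.pair_iff] at hl
  let s0 := v₂ i • v₁ + (- v₁ i) • v₂
  have hs0 : s0 ≠ 0 := by
    intro h0
    have := hl _ _ h0
    simp at this
    tauto
  have hs0i : s0 i = 0 := by simp [s0]; ring
  obtain ⟨j, hj⟩ := Function.ne_iff.1 hs0
  simp only [Pi.zero_apply] at hj
  let s := (s0 j)⁻¹ • s0
  have hsj : s j = 1 := by simp [s, hj]
  have hs : SingV F s := (h _ _).smul hh _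
  have hsi : s i = 0 := by simp [s, hs0i]
  refine ⟨s, fun h0 => by simp [h0] at hsj, hs, ?_, hsi⟩
  obtain ⟨a, b, hab⟩ := mem_line hF hh (LinearIndependent.pair_iff.2 hl) h (sing_frob φ hφ hs)
  have hpi : a * v₁ i + b * v₂ i = 0 := by
    have := congrFun hab i
    simp [hsi] at this
    exact this.symm
  obtain ⟨c, hc⟩ : ∃ c : K, φ ∘ s = c • s0 := by
    rw [hab]
    rcases hi with hi | hi
    · refine ⟨-b / v₁ i, ?_⟩
      have : a = -b / v₁ i * v₂ i := by field_simp; linear_combination hpi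
      simp only [s0, smul_add, smul_smul]
      rw [← this]; congr 2; field_simp
    · refine ⟨a / v₂ i, ?_⟩
      have : b = a / v₂ i * (-v₁ i) := by field_simp; linear_combination hpi
      simp only [s0, smul_add, smul_smul]
      rw [← this]; congr 2; field_simp
  have h1 := congrFun hc j
  simp [hsj] at h1
  rw [hc]
  simp only [s]
  congr 1
  exact eq_inv_of_mul_eq_one_left h1.symm

lemma rational_double_of_line [IsAlgClosed K] (φ : K →+* K) {F : MvPolynomial (Fin 4) K} (hφ : map φ F = F)
    (hF : Irreducible F) (hh : F.IsHomogeneous 3)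
    {v₁ v₂ : Fin 4 → K} (hl : LinearIndependent K ![v₁, v₂])
    (h : ∀ a b : K, SingV F (a • v₁ + b • v₂)) :
    ∃ s : Fin 4 → K, s ≠ 0 ∧ SingV F s ∧ φ ∘ s = s ∧ ∃ w, dd F w s ≠ 0 := by
  haveI : Infinite K := IsAlgClosed.instInfinite
  have hl' := LinearIndependent.pair_iff.1 hl
  have hv1 : v₁ ≠ 0 := by
    rintro rfl
    simpa using hl' 1 0 (by simp)
  obtain ⟨i, hi⟩ := Function.ne_iff.1 hv1
  obtain ⟨s, hs0, hs, hsφ, -⟩ := rational_on_line φ hφ hF hh hl h i (Or.inl hi)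
  by_cases hd : ∃ w, dd F w s ≠ 0
  · exact ⟨s, hs0, hs, hsφ, hd⟩
  push Not at hd
  obtain ⟨a, b, hab⟩ := mem_line hF hh hl h hs
  obtain ⟨j, hj⟩ := Function.ne_iff.1 hs0
  have hj' : v₁ j ≠ 0 ∨ v₂ j ≠ 0 := by
    by_contra hcon
    push Not at hcon
    apply hj; rw [hab]; simp [hcon]
  obtain ⟨r, hr0, hr, hrφ, hrj⟩ := rational_on_line φ hφ hF hh hl h j hj'
  refine ⟨r, hr0, hr, hrφ, ?_⟩
  by_contra hcon
  push Not at hcon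
  refine two_trip hF hh (v₁ := s) (v₂ := r) ?_ ⟨hs, hd⟩ ⟨hr, hcon⟩
  rw [LinearIndependent.pair_iff]
  intro x y hxy
  have h1 := congrFun hxy j
  simp [hrj] at h1
  have hx : x = 0 := by rcases h1 with h1 | h1; exact h1; exact absurd h1 hj
  subst hx
  simp [hr0] at hxy
  exact ⟨rfl, hxy⟩

lemma pderiv_lsub {m : ℕ} (T : Matrix (Fin m) (Fin n) K) (F : MvPolynomial (Fin m) K) (k : Fin n) :
    pderiv k (lsub T F) = ∑ i, C (T i k) * lsub T (pderiv i F) := by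
  classical
  induction F using MvPolynomial.induction_on with
  | C a => simp [lsub]
  | add p q hp hq => simp [hp, hq, mul_add, Finset.sum_add_distrib]
  | mul_X p j hp =>
    have h1 : ∀ i, lsub T (pderiv i (p * X j)) = lsub T p * (if j = i then 1 else 0) + lsub T (X j) * lsub T (pderiv i p) := by
      intro i
      simp [Derivation.leibniz, pderiv_X, Pi.single_apply]
      split_ifs <;> simp
    have h2 : pderiv k (lsub T (X j)) = C (T j k) := by
      simp [lsub, Derivation.leibniz, pderiv_X, Pi.single_apply]
    rw [map_mul, Derivation.leibniz, hp, h2]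
    simp only [h1, mul_add, Finset.sum_add_distrib, smul_eq_mul, Finset.mul_sum]
    congr 1
    · simp; ring
    · exact Finset.sum_congr rfl fun i _ => by ring

lemma dd_lsub {m : ℕ} (T : Matrix (Fin m) (Fin n) K) (F : MvPolynomial (Fin m) K) (u w : Fin n → K) :
    dd (lsub T F) u w = dd F (T.mulVec u) (T.mulVec w) := by
  simp only [dd, pderiv_lsub, map_sum, map_mul, eval_C, eval_lsub, Finset.mul_sum, Matrix.mulVec, dotProduct,
    Finset.sum_mul]
  rw [Finset.sum_comm]
  refine Finset.sum_congr rfl fun i _ => Finset.sum_congr rfl fun j _ => ?_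
  ring

end PD

lemma dd_lin {K : Type*} [Field K] {n : ℕ} (F : MvPolynomial (Fin n) K) (v : Fin n → K) (a b : K) (x y : Fin n → K) :
    dd F v (a • x + b • y) = a * dd F v x + b * dd F v y := by
  simp only [dd, Pi.add_apply, Pi.smul_apply, smul_eq_mul, Finset.mul_sum, ← Finset.sum_add_distrib]
  exact Finset.sum_congr rfl fun i _ => by ring

lemma cone_sing (F : MvPolynomial (Fin 4) (Kbar Fq)) (hF : Irreducible F) (hh : F.IsHomogeneous 3)
    (hnc : ¬ IsConeOverSmoothCubic F) {v : Fin 4 → Kbar Fq} (hv0 : v ≠ 0) (hv : TripV F v) :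
    ∃ s, SingV F s ∧ LinearIndependent (Kbar Fq) ![v, s] := by
  classical
  haveI : Infinite (Kbar Fq) := IsAlgClosed.instInfinite
  by_contra hcon
  apply hnc
  obtain ⟨i, hi⟩ := Function.ne_iff.1 hv0
  simp only [Pi.zero_apply] at hi
  let M : Matrix (Fin 4) (Fin 3) (Kbar Fq) := fun a j => if a = i.succAbove j then 1 else 0
  have hMi : ∀ w, M.mulVec w i = 0 := by
    intro w; simp [M, Matrix.mulVec, dotProduct]
  have hMs : ∀ w j, M.mulVec w (i.succAbove j) = w j := by
    intro w j; simp [M, Matrix.mulVec, dotProduct]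
  have hMx : ∀ x : Fin 4 → Kbar Fq, x i = 0 → M.mulVec (fun j => x (i.succAbove j)) = x := by
    intro x hx
    ext a
    rcases Fin.eq_self_or_eq_succAbove i a with rfl | ⟨j, rfl⟩
    · rw [hMi, hx]
    · rw [hMs]
  have hinj : Function.Injective M.mulVec := by
    intro x y hxy
    ext j; rw [← hMs x j, ← hMs y j, hxy]
  have hinv : ∀ (a : Kbar Fq) x, eval (a • v + x) F = eval x F := by
    intro a x
    have := ev_add hh a 1 v x
    rw [one_smul, hv.1.1, hv.1.2, hv.2] at this
    simpa using this
  let N : Matrix (Fin 3) (Fin 4) (Kbar Fq) := fun j a =>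
    (if a = i.succAbove j then 1 else 0) + (if a = i then - (v (i.succAbove j) / v i) else 0)
  have hN : ∀ x j, N.mulVec x j = x (i.succAbove j) - (x i / v i) * v (i.succAbove j) := by
    intro x j
    simp [N, Matrix.mulVec, dotProduct, add_mul, Finset.sum_add_distrib]; ring
  have hMN : ∀ x, M.mulVec (N.mulVec x) = (-(x i / v i)) • v + x := by
    intro x
    rw [← hMx ((-(x i / v i)) • v + x) (by simp [hi])]
    congr 1; ext j; rw [hN]; simp; ring
  have hNM : ∀ w, N.mulVec (M.mulVec w) = w := by
    intro w; ext j; rw [hN, hMi, hMs]; simp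
  have hrepv := Projectivization.exists_smul_eq_mk_rep (Kbar Fq) v hv0
  obtain ⟨a, ha⟩ := hrepv
  have hPi : (Projectivization.mk (Kbar Fq) v hv0).rep i ≠ 0 := by
    rw [← ha]; simp [Units.smul_def, hi]
  refine ⟨Projectivization.mk _ v hv0, Pi.single i 1, M, by simp, ?_, hinj, ?_, ?_, ?_, ?_⟩
  · simpa [Pi.single_apply] using hPi
  · intro w; simp [Pi.single_apply, hMi]
  · have hsum : ∀ x : P3 Fq, (∑ j, (Pi.single i (1 : Kbar Fq) : Fin 4 → Kbar Fq) j * x.rep j = 0) ↔ x.rep i = 0 := by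
      intro x; simp [Pi.single_apply]
    ext p
    simp only [Set.mem_iUnion, Set.mem_inter_iff, Set.mem_setOf_eq, hsum, exists_prop, projZeros, lineThrough]
    constructor
    · intro hp
      by_cases hx : (-(p.rep i / v i)) • v + p.rep = 0
      · -- p is the vertex
        obtain ⟨α, β, hαβ, h0⟩ := binary_zero hh (M.mulVec (Pi.single 0 1)) (M.mulVec (Pi.single 1 1))
        have hy : α • M.mulVec (Pi.single 0 1) + β • M.mulVec (Pi.single 1 1) = M.mulVec ![α, β, 0] := by
          rw [← Matrix.mulVec_smul, ← Matrix.mulVec_smul, ← Matrix.mulVec_add]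
          congr 1; ext j; fin_cases j <;> simp
        have hy0 : M.mulVec ![α, β, 0] ≠ 0 := by
          intro h1
          have := hinj (h1.trans (Matrix.mulVec_zero M).symm)
          have e0 := congrFun this 0
          have e1 := congrFun this 1
          simp at e0 e1
          tauto
        obtain ⟨c, hc⟩ := Projectivization.exists_smul_eq_mk_rep (Kbar Fq) _ hy0
        rw [hy] at h0
        refine ⟨Projectivization.mk _ _ hy0, ⟨?_, ?_⟩, 1, 0, ?_, ?_⟩
        · rw [← hc, Units.smul_def, ev_smul hh, h0, mul_zero]
        · rw [← hc]; simp [Units.smul_def, hMi]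
        · simpa using Projectivization.rep_nonzero _
        · conv_lhs => rw [← Projectivization.mk_rep p]
          rw [Projectivization.mk_eq_mk_iff']
          refine ⟨(p.rep i / v i) * (↑a)⁻¹, ?_⟩
          rw [← ha]
          simp only [Units.smul_def, one_smul, zero_smul, add_zero, smul_smul]
          rw [mul_assoc, one_mul, inv_mul_cancel₀ a.ne_zero, mul_one]
          rw [neg_smul, neg_add_eq_zero] at hx
          exact hx
      · obtain ⟨c, hc⟩ := Projectivization.exists_smul_eq_mk_rep (Kbar Fq) _ hx
        have hcomb : (p.rep i / v i * (↑a)⁻¹) • (Projectivization.mk (Kbar Fq) v hv0).rep +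
            ((↑c)⁻¹ : Kbar Fq) • (Projectivization.mk (Kbar Fq) _ hx).rep = p.rep := by
          rw [← ha, ← hc]
          simp only [Units.smul_def, smul_smul]
          rw [mul_assoc, inv_mul_cancel₀ a.ne_zero, inv_mul_cancel₀ c.ne_zero]
          module
        refine ⟨Projectivization.mk _ _ hx, ⟨?_, ?_⟩, _, _, hcomb ▸ p.rep_nonzero, ?_⟩
        · rw [← hc, Units.smul_def, ev_smul hh, hinv, hp, mul_zero]
        · rw [← hc]; simp [Units.smul_def, hi]
        · simp only [hcomb, Projectivization.mk_rep]
    · rintro ⟨Q, ⟨hQ, -⟩, x, y, h0, rfl⟩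
      obtain ⟨c, hc⟩ := Projectivization.exists_smul_eq_mk_rep (Kbar Fq) _ h0
      rw [← hc, Units.smul_def, ev_smul hh, ← ha, Units.smul_def, smul_smul, hinv, ev_smul hh, hQ]
      simp
  · refine irr_transfer (lsub M).toRingHom (lsub N).toRingHom F hF ?_ ?_
    · apply MvPolynomial.funext; intro x
      simp only [AlgHom.toRingHom_eq_coe, RingHom.coe_coe, eval_lsub, hMN, hinv]
    · intro b; apply MvPolynomial.funext; intro x
      simp only [AlgHom.toRingHom_eq_coe, RingHom.coe_coe, eval_lsub, hNM]
  · rintro w hw ⟨h1, h2⟩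
    have h3 : SingV (lsub M F) w := (singV_iff _ _).2 ⟨h1, h2⟩
    apply hcon
    refine ⟨M.mulVec w, ⟨by rw [← eval_lsub]; exact h3.1, fun z => ?_⟩, ?_⟩
    · have hz : z = (z i / v i) • v + (1 : Kbar Fq) • M.mulVec (N.mulVec z) := by rw [hMN]; module
      rw [hz, dd_lin, hv.2, ← dd_lsub, h3.2]; simp
    · rw [LinearIndependent.pair_iff]
      intro x y hxy
      have e1 := congrFun hxy i
      simp [hMi, hi] at e1
      subst e1
      refine ⟨rfl, ?_⟩
      by_contra hy
      simp [hy] at hxy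
      exact hw (hinj (hxy.trans (Matrix.mulVec_zero M).symm))

section PE

/-- coordinatewise embedding of rational vectors -/
def emb (x : Fin 4 → Fq) : Fin 4 → Kbar Fq := fun i => algebraMap Fq (Kbar Fq) (x i)

lemma emb_inj {x y : Fin 4 → Fq} (h : emb x = emb y) : x = y := by
  ext i
  exact (algebraMap Fq (Kbar Fq)).injective (congrFun h i)

lemma exists_base {y : Kbar Fq} (h : y ^ Fintype.card Fq = y) : ∃ x : Fq, algebraMap Fq (Kbar Fq) x = y := by
  classical
  let p : Polynomial (Kbar Fq) := Polynomial.X ^ Fintype.card Fq - Polynomial.X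
  have hp0 : p ≠ 0 := FiniteField.X_pow_card_sub_X_ne_zero _ Fintype.one_lt_card
  have hdeg : p.natDegree = Fintype.card Fq :=
    FiniteField.X_pow_card_sub_X_natDegree_eq _ Fintype.one_lt_card
  let I : Finset (Kbar Fq) := Finset.univ.image (algebraMap Fq (Kbar Fq))
  have hI : I.card = Fintype.card Fq := by
    rw [Finset.card_image_of_injective _ (algebraMap Fq (Kbar Fq)).injective, Finset.card_univ]
  have hsub : I ⊆ p.roots.toFinset := by
    intro z hz
    obtain ⟨x, -, rfl⟩ := Finset.mem_image.1 hz
    rw [Multiset.mem_toFinset, Polynomial.mem_roots hp0]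
    simp [p, Polynomial.IsRoot, ← map_pow, FiniteField.pow_card]
  have heq : I = p.roots.toFinset := by
    apply Finset.eq_of_subset_of_card_le hsub
    rw [hI, ← hdeg]
    exact (Multiset.toFinset_card_le _).trans (Polynomial.card_roots' _)
  have hy : y ∈ I := by
    rw [heq, Multiset.mem_toFinset, Polynomial.mem_roots hp0]
    simp [p, Polynomial.IsRoot, h]
  obtain ⟨x, -, hx⟩ := Finset.mem_image.1 hy
  exact ⟨x, hx⟩

lemma exists_emb {y : Fin 4 → Kbar Fq} (h : ∀ i, y i ^ Fintype.card Fq = y i) : ∃ x : Fin 4 → Fq, emb x = y := by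
  choose x hx using fun i => exists_base (h i)
  exact ⟨x, funext hx⟩

/-- affine zeros -/
def affZ (F : MvPolynomial (Fin 4) (Kbar Fq)) : Set (Fin 4 → Fq) := {x | eval (emb x) F = 0}

lemma emb_smul (a : Fq) (x : Fin 4 → Fq) : emb (a • x) = algebraMap Fq (Kbar Fq) a • emb x := by
  ext i; simp [emb]

lemma emb_add (x y : Fin 4 → Fq) : emb (x + y) = emb x + emb y := by
  ext i; simp [emb]

lemma emb_zero : emb (0 : Fin 4 → Fq) = 0 := by
  ext i; simp [emb]

lemma proj_aff (F : MvPolynomial (Fin 4) (Kbar Fq)) (hh : F.IsHomogeneous 3) :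
    Nat.card {p : P3 Fq // p ∈ projZeros F ∧ IsRatPoint (Fintype.card Fq) p} * (Fintype.card Fq - 1) + 1
      ≤ (affZ F).ncard := by
  classical
  let A := {p : P3 Fq // p ∈ projZeros F ∧ IsRatPoint (Fintype.card Fq) p}
  have hA : ∀ p : A, ∃ x : Fin 4 → Fq, ∃ h : emb x ≠ 0, Projectivization.mk (Kbar Fq) (emb x) h = p.1 := by
    rintro ⟨p, hp, v, hv, hvp, hr⟩
    obtain ⟨x, rfl⟩ := exists_emb hr
    exact ⟨x, hv, hvp⟩
  choose f hf0 hf using hA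
  have hf0' : ∀ p, f p ≠ 0 := fun p h => hf0 p (by rw [h, emb_zero])
  have hz : ∀ p, f p ∈ affZ F := by
    intro p
    have h1 := p.2.1
    rw [← hf p] at h1
    obtain ⟨a, ha⟩ := Projectivization.exists_smul_eq_mk_rep (Kbar Fq) _ (hf0 p)
    have h2 : eval (Projectivization.mk (Kbar Fq) (emb (f p)) (hf0 p)).rep F = 0 := h1
    rw [← ha, Units.smul_def, ev_smul hh] at h2
    have h3 : eval (emb (f p)) F = 0 := by simpa using h2
    exact h3
  let g : Option (A × Fqˣ) → affZ F := fun o => match o with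
    | none => ⟨0, by
        have := ev_smul hh 0 (0 : Fin 4 → Kbar Fq)
        simp only [affZ, Set.mem_ofPred_eq, emb_zero]
        simpa using this⟩
    | some (p, a) => ⟨(a : Fq) • f p, by
        have := hz p
        simp only [affZ, Set.mem_ofPred_eq] at this ⊢
        rw [emb_smul, ev_smul hh, this, mul_zero]⟩
  have hg : Function.Injective g := by
    rintro (_ | ⟨p, a⟩) (_ | ⟨p', a'⟩) h
    · rfl
    · simp [g] at h
      exact absurd h.symm (by simp [hf0'])
    · simp [g] at h
      exact absurd h (by simp [hf0'])
    · simp only [g, Subtype.mk.injEq] at h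
      have hp : p = p' := by
        apply Subtype.ext
        rw [← hf p, ← hf p', Projectivization.mk_eq_mk_iff']
        have h2 := congrArg emb h
        rw [emb_smul, emb_smul] at h2
        refine ⟨(algebraMap Fq (Kbar Fq) a)⁻¹ * algebraMap Fq (Kbar Fq) a', ?_⟩
        rw [mul_smul, ← h2, smul_smul, inv_mul_cancel₀ (by simp), one_smul]
      subst hp
      have : (a : Fq) = a' := smul_left_injective Fq (hf0' p) h
      rw [Units.ext this]
  have hfinA : Finite A := by
    have : Function.Injective f := by
      intro p p' h
      apply Subtype.ext
      rw [← hf p, ← hf p']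
      simp [h]
    exact Finite.of_injective f this
  have := Nat.card_le_card_of_injective g hg
  rw [Finite.card_option, Nat.card_prod, Nat.card_eq_fintype_card (α := Fqˣ), Fintype.card_units] at this
  rw [← Nat.card_coe_set_eq]
  exact this

/-- Few directions bound the cardinality. -/
lemma few_dirs (Z : Finset (Fin 3 → Fq))
    (h : ∀ s : Fin 7 → Fin 3 → Fq, (∀ j, s j ∈ Z ∧ s j ≠ 0) → ∃ i j, i ≠ j ∧ ∃ c : Fq, s i = c • s j) :
    Z.card ≤ 1 + 6 * (Fintype.card Fq - 1) := by
  classical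
  let Z' := Z.erase 0
  have h1 : Z.card ≤ Z'.card + 1 := by
    have := Finset.pred_card_le_card_erase (s := Z) (a := 0)
    change _ ≤ (Z.erase 0).card + 1
    omega
  let f : (Fin 3 → Fq) → Submodule Fq (Fin 3 → Fq) := fun z => Submodule.span Fq {z}
  have h6 : (Z'.image f).card ≤ 6 := by
    by_contra hcon
    push Not at hcon
    obtain ⟨T, hT, hT7⟩ := Finset.exists_subset_card_eq (show 7 ≤ (Z'.image f).card from hcon)
    let e := T.equivFinOfCardEq hT7
    have : ∀ j : Fin 7, ∃ z ∈ Z', f z = (e.symm j).1 := fun j => Finset.mem_image.1 (hT (e.symm j).2)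
    choose s hs hsf using this
    obtain ⟨i, j, hij, c, hc⟩ := h s (fun j => ⟨Finset.mem_of_mem_erase (hs j), Finset.ne_of_mem_erase (hs j)⟩)
    apply hij
    apply e.symm.injective
    apply Subtype.ext
    rw [← hsf, ← hsf]
    have hc0 : c ≠ 0 := by
      rintro rfl
      exact Finset.ne_of_mem_erase (hs i) (by simpa using hc)
    simp only [f, hc]
    exact Submodule.span_singleton_smul_eq (IsUnit.mk0 c hc0) _
  have h2 : Z'.card ≤ (Fintype.card Fq - 1) * (Z'.image f).card := by
    apply Finset.card_le_mul_card_image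
    intro b hb
    obtain ⟨z, hz, rfl⟩ := Finset.mem_image.1 hb
    have : (Z'.filter fun y => f y = f z) ⊆ (Finset.univ : Finset Fqˣ).image (fun a : Fqˣ => (a : Fq) • z) := by
      intro y hy
      obtain ⟨-, hy⟩ := Finset.mem_filter.1 hy
      obtain ⟨a, ha⟩ := Submodule.span_singleton_eq_span_singleton.1 hy.symm
      exact Finset.mem_image.2 ⟨a, Finset.mem_univ _, ha⟩
    refine (Finset.card_le_card this).trans (Finset.card_image_le.trans ?_)
    rw [Finset.card_univ, Fintype.card_units]
  have h3 := Nat.mul_le_mul_left (Fintype.card Fq - 1) h6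
  omega

end PE

section PF

lemma not_li_three {K : Type*} [Field K] {v x y : Fin 4 → K} (i : Fin 4) (hv : v i ≠ 0) (hx : x i = 0)
    (hy : y i = 0) (hxy : LinearIndependent K ![x, y]) : LinearIndependent K ![v, x, y] := by
  rw [LinearIndependent.pair_iff] at hxy
  rw [Fintype.linearIndependent_iff]
  intro g hg
  simp [Fin.sum_univ_three] at hg
  have h0 : g 0 = 0 := by
    have := congrFun hg i
    simpa [hx, hy, hv] using this
  rw [h0, zero_smul, zero_add] at hg
  obtain ⟨h1, h2⟩ := hxy _ _ hg
  intro j; fin_cases j <;> assumption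

lemma emb_li {x y : Fin 4 → Fq} (hx : x ≠ 0) (hy : y ≠ 0) (h : ¬ ∃ c : Fq, y = c • x) :
    LinearIndependent (Kbar Fq) ![emb x, emb y] := by
  rw [LinearIndependent.pair_iff]
  intro a b hab
  obtain ⟨i, hi⟩ := Function.ne_iff.1 hx
  simp only [Pi.zero_apply] at hi
  have hi' : algebraMap Fq (Kbar Fq) (x i) ≠ 0 := by simpa using hi
  have e : ∀ j, a * algebraMap Fq (Kbar Fq) (x j) + b * algebraMap Fq (Kbar Fq) (y j) = 0 := by
    intro j
    simpa [emb] using congrFun hab j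
  have hb : b = 0 := by
    by_contra hb
    apply h
    refine ⟨y i / x i, ?_⟩
    ext j
    apply (algebraMap Fq (Kbar Fq)).injective
    simp only [Pi.smul_apply, smul_eq_mul, map_mul, map_div₀]
    rw [div_mul_eq_mul_div, eq_div_iff hi']
    apply mul_left_cancel₀ hb
    linear_combination algebraMap Fq (Kbar Fq) (x i) * e j - algebraMap Fq (Kbar Fq) (x j) * e i
  refine ⟨?_, hb⟩
  have := e i
  simpa [hb, hi'] using this

lemma count_double (F : MvPolynomial (Fin 4) (Kbar Fq)) (hF : Irreducible F) (hh : F.IsHomogeneous 3)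
    (v : Fin 4 → Fq) (hv : v ≠ 0) (hs : SingV F (emb v)) (hd : ∃ w, dd F w (emb v) ≠ 0) :
    (affZ F).ncard ≤ Fintype.card Fq ^ 3 + (Fintype.card Fq - 1) * (1 + 6 * (Fintype.card Fq - 1)) := by
  classical
  set q := Fintype.card Fq with hq
  obtain ⟨i, hi⟩ := Function.ne_iff.1 hv
  simp only [Pi.zero_apply] at hi
  have hev : emb v ≠ 0 := fun h => hv (emb_inj (h.trans emb_zero.symm))
  let U : (Fin 3 → Fq) → (Fin 4 → Fq) := fun w => i.insertNth 0 w
  have hUi : ∀ w, U w i = 0 := fun w => by simp [U]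
  have hUs : ∀ w j, U w (i.succAbove j) = w j := fun w j => by simp [U]
  let g : (Fin 4 → Fq) → (Fin 3 → Fq) := fun x j => x (i.succAbove j) - x i / v i * v (i.succAbove j)
  have hgx : ∀ x, x = (x i / v i) • v + U (g x) := by
    intro x
    ext a
    rcases Fin.eq_self_or_eq_succAbove i a with rfl | ⟨j, rfl⟩
    · simp [hUi, hi]
    · simp [hUs, g]
  let Z : Finset (Fin 3 → Fq) :=
    Finset.univ.filter fun w => eval (emb (U w)) F = 0 ∧ dd F (emb (U w)) (emb v) = 0
  have hZ : Z.card ≤ 1 + 6 * (q - 1) := by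
    apply few_dirs
    intro s hsZ
    obtain ⟨a, b, hab, hli⟩ := double_pt hF hh hev hs hd (fun j => emb (U (s j)))
      (fun j => (Finset.mem_filter.1 (hsZ j).1).2)
    refine ⟨b, a, hab.symm, ?_⟩
    by_contra hcon
    apply hli
    have hU0 : ∀ j, U (s j) ≠ 0 := by
      intro j h0
      apply (hsZ j).2
      ext k
      rw [← hUs (s j) k, h0]; rfl
    apply not_li_three i (by simpa [emb] using hi) (by simp [emb, hUi]) (by simp [emb, hUi])
    apply emb_li (hU0 a) (hU0 b)
    rintro ⟨c, hc⟩
    apply hcon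
    refine ⟨c, ?_⟩
    ext k
    have := congrFun hc (i.succAbove k)
    simpa [hUs] using this
  let A : Finset (Fin 4 → Fq) := Finset.univ.filter fun x => x ∈ affZ F
  have hA : (affZ F).ncard = A.card := by
    rw [← Set.ncard_coe_finset]; congr 1; ext x; simp [A]
  rw [hA, Finset.card_eq_sum_card_fiberwise (f := g) (t := Finset.univ) (fun _ _ => by simp)]
  have hfib : ∀ w ∈ (Finset.univ : Finset (Fin 3 → Fq)), (A.filter fun x => g x = w).card ≤
      1 + if w ∈ Z then q - 1 else 0 := by
    intro w _
    have hinj : Set.InjOn (fun x : Fin 4 → Fq => x i) (A.filter fun x => g x = w) := by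
      intro x hx y hy hxy
      have hx' := (Finset.mem_filter.1 hx).2
      have hy' := (Finset.mem_filter.1 hy).2
      simp only at hxy
      rw [hgx x, hgx y, hx', hy', hxy]
    split_ifs with hw
    · have : 1 + (q - 1) = q := by have : 0 < q := Fintype.card_pos; omega
      rw [this, ← Finset.card_image_of_injOn hinj]
      exact Finset.card_le_univ _
    · rw [Finset.card_le_one]
      intro x hx y hy
      apply hinj hx hy
      simp only
      have key : ∀ z ∈ A.filter fun x => g x = w,
          algebraMap Fq (Kbar Fq) (z i / v i) * dd F (emb (U w)) (emb v) + eval (emb (U w)) F = 0 := by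
        intro z hz
        obtain ⟨hz1, hz2⟩ := Finset.mem_filter.1 hz
        have hz3 : eval (emb z) F = 0 := (Finset.mem_filter.1 hz1).2
        rw [hgx z, hz2, emb_add, emb_smul] at hz3
        have := ev_add hh (algebraMap Fq (Kbar Fq) (z i / v i)) 1 (emb v) (emb (U w))
        rw [one_smul, hz3, hs.1, hs.2] at this
        linear_combination -this
      have hx1 := key x hx
      have hy1 := key y hy
      have hd0 : dd F (emb (U w)) (emb v) ≠ 0 := by
        intro h0
        apply hw
        rw [Finset.mem_filter]
        refine ⟨Finset.mem_univ _, ?_, h0⟩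
        simpa [h0] using hx1
      have : algebraMap Fq (Kbar Fq) (x i / v i) = algebraMap Fq (Kbar Fq) (y i / v i) := by
        apply mul_right_cancel₀ hd0
        linear_combination hx1 - hy1
      have := (algebraMap Fq (Kbar Fq)).injective this
      exact (div_left_inj' hi).1 this
  refine (Finset.sum_le_sum hfib).trans ?_
  rw [Finset.sum_add_distrib]
  simp only [Finset.sum_const, Finset.card_univ, smul_eq_mul, mul_one, Fintype.card_pi, Finset.prod_const,
    Fintype.card_fin, Finset.sum_ite_mem, Finset.univ_inter]
  rw [← hq, mul_comm Z.card]
  exact Nat.add_le_add_left (Nat.mul_le_mul_left _ hZ) _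

lemma bound_double (F : MvPolynomial (Fin 4) (Kbar Fq)) (hF : Irreducible F) (hh : F.IsHomogeneous 3)
    (v : Fin 4 → Fq) (hv : v ≠ 0) (hs : SingV F (emb v)) (hd : ∃ w, dd F w (emb v) ≠ 0) :
    Nat.card {p : P3 Fq // p ∈ projZeros F ∧ IsRatPoint (Fintype.card Fq) p} ≤
      Fintype.card Fq ^ 2 + 7 * Fintype.card Fq + 1 := by
  have h1 := proj_aff F hh
  have h2 := count_double F hF hh v hv hs hd
  have hq : 1 < Fintype.card Fq := Fintype.one_lt_card
  generalize Nat.card {p : P3 Fq // p ∈ projZeros F ∧ IsRatPoint (Fintype.card Fq) p} = N at *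
  generalize Fintype.card Fq = q at *
  obtain ⟨k, rfl⟩ : ∃ k, q = k + 1 := ⟨q - 1, by omega⟩
  simp only [Nat.add_sub_cancel] at *
  have hk : 0 < k := by omega
  apply Nat.le_of_mul_le_mul_right _ hk
  nlinarith [h1.trans h2]

end PF

section PG

/-- the q-Frobenius of the algebraic closure -/
def frq (Fq : Type) [Field Fq] [Fintype Fq] : Kbar Fq →+* Kbar Fq :=
  (FiniteField.frobeniusAlgHom Fq (Kbar Fq)).toRingHom

lemma frq_apply (x : Kbar Fq) : frq Fq x = x ^ Fintype.card Fq := rfl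

lemma frq_alg (x : Fq) : frq Fq (algebraMap Fq (Kbar Fq) x) = algebraMap Fq (Kbar Fq) x := by
  rw [frq_apply, ← map_pow, FiniteField.pow_card]

lemma count_pair (F : MvPolynomial (Fin 4) (Kbar Fq)) (hF : Irreducible F) (hh : F.IsHomogeneous 3)
    (r s : Fin 4 → Kbar Fq) (hr : SingV F r) (hs : SingV F s) (hrs : frq Fq ∘ r = s) (hsr : frq Fq ∘ s = r)
    (i j : Fin 4) (hi : r i = 1) (hj : r j ≠ s j) :
    (affZ F).ncard ≤ Fintype.card Fq ^ 2 + (Fintype.card Fq ^ 2 - 1) * (Fintype.card Fq + 1) := by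
  classical
  have : Infinite (Kbar Fq) := IsAlgClosed.instInfinite
  set q := Fintype.card Fq with hq
  let ι := algebraMap Fq (Kbar Fq)
  have hrs' : ∀ k, frq Fq (r k) = s k := fun k => congrFun hrs k
  have hsr' : ∀ k, frq Fq (s k) = r k := fun k => congrFun hsr k
  have hsi : s i = 1 := by rw [← hrs', hi, map_one]
  have hij : i ≠ j := by rintro rfl; exact hj (by rw [hi, hsi])
  have hj' : r j - s j ≠ 0 := sub_ne_zero.2 hj
  let α : (Fin 4 → Fq) → Kbar Fq := fun x => (ι (x j) - ι (x i) * s j) / (r j - s j)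
  have hα : ∀ x, frq Fq (α x) = (ι (x j) - ι (x i) * r j) / (s j - r j) := by
    intro x
    simp only [α, map_div₀, map_sub, map_mul, hrs', hsr', ι, frq_alg]
  have hα2 : ∀ x, frq Fq (frq Fq (α x)) = α x := by
    intro x
    rw [hα]
    simp only [α, map_div₀, map_sub, map_mul, hrs', hsr', ι, frq_alg]
  have hg : ∀ x, ∃ y : Fin 4 → Fq, emb x = emb y + α x • r + frq Fq (α x) • s := by
    intro x
    obtain ⟨y, hy⟩ := exists_emb (y := emb x - α x • r - frq Fq (α x) • s) (by
      intro k
      rw [← frq_apply]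
      simp only [Pi.sub_apply, Pi.smul_apply, smul_eq_mul, map_sub, map_mul, hα2, hrs', hsr', emb, frq_alg]
      ring)
    exact ⟨y, by rw [hy]; abel⟩
  choose g hg using hg
  have hgi : ∀ x, g x i = 0 := by
    intro x
    have := congrFun (hg x) i
    apply (algebraMap Fq (Kbar Fq)).injective
    simp only [emb, Pi.add_apply, Pi.smul_apply, smul_eq_mul, hi, hsi, hα] at this
    have e : α x + (ι (x j) - ι (x i) * r j) / (s j - r j) = ι (x i) := by
      rw [← neg_sub (r j), div_neg]
      simp only [α]; field_simp; ring
    rw [map_zero]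
    linear_combination -this - e
  have hgj : ∀ x, g x j = 0 := by
    intro x
    have := congrFun (hg x) j
    apply (algebraMap Fq (Kbar Fq)).injective
    simp only [emb, Pi.add_apply, Pi.smul_apply, smul_eq_mul, hα] at this
    have e : α x * r j + (ι (x j) - ι (x i) * r j) / (s j - r j) * s j = ι (x j) := by
      rw [← neg_sub (r j), div_neg]
      simp only [α]; field_simp; ring
    rw [map_zero]
    linear_combination -this - e
  let V : Finset (Fin 4 → Fq) := Finset.univ.filter fun y => y i = 0 ∧ y j = 0
  have hV : V.card ≤ q ^ 2 := by
    have hinj : Set.InjOn (fun (y : Fin 4 → Fq) (k : {k : Fin 4 // k ≠ i ∧ k ≠ j}) => y k.1) V := by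
      intro x hx y hy hxy
      have hx' := (Finset.mem_filter.1 hx).2
      have hy' := (Finset.mem_filter.1 hy).2
      ext k
      by_cases h1 : k = i
      · rw [h1, hx'.1, hy'.1]
      by_cases h2 : k = j
      · rw [h2, hx'.2, hy'.2]
      exact congrFun hxy ⟨k, h1, h2⟩
    rw [← Finset.card_image_of_injOn hinj]
    refine (Finset.card_le_univ _).trans ?_
    have h2 : Fintype.card {k : Fin 4 // k ≠ i ∧ k ≠ j} = 2 := by
      clear * - hij
      revert i j
      decide
    rw [Fintype.card_fun, h2]
  let A : Finset (Fin 4 → Fq) := Finset.univ.filter fun x => x ∈ affZ F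
  have hA : (affZ F).ncard = A.card := by
    rw [← Set.ncard_coe_finset]; congr 1; ext x; simp [A]
  rw [hA, Finset.card_eq_sum_card_fiberwise (f := g) (t := V) (fun x _ => by simp [V, hgi, hgj])]
  have h0V : (0 : Fin 4 → Fq) ∈ V := by simp [V]
  rw [← Finset.add_sum_erase _ _ h0V]
  apply Nat.add_le_add
  · have hinj : Set.InjOn (fun x : Fin 4 → Fq => (x i, x j)) (A.filter fun x => g x = 0) := by
      intro x hx y hy hxy
      have hx' := (Finset.mem_filter.1 hx).2
      have hy' := (Finset.mem_filter.1 hy).2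
      simp only [Prod.mk.injEq] at hxy
      apply emb_inj
      rw [hg x, hg y, hx', hy']
      simp only [α, hxy.1, hxy.2]
    rw [← Finset.card_image_of_injOn hinj]
    refine (Finset.card_le_univ _).trans ?_
    rw [Fintype.card_prod, sq]
  · refine (Finset.sum_le_card_nsmul _ _ (q + 1) ?_).trans ?_
    · intro u hu
      obtain ⟨hu0, huV⟩ := Finset.mem_erase.1 hu
      obtain ⟨hui, huj⟩ := (Finset.mem_filter.1 huV).2
      let p : Polynomial (Kbar Fq) := Polynomial.C (eval (emb u) F) + Polynomial.C (dd F (emb u) r) * Polynomial.X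
        + Polynomial.C (dd F (emb u) s) * Polynomial.X ^ q + Polynomial.C (bb F (emb u) r s) * Polynomial.X ^ (q + 1)
      have hq1 : 1 < q := Fintype.one_lt_card
      have hp : p ≠ 0 := by
        intro hp
        have c0 := congrArg (fun f => Polynomial.coeff f 0) hp
        have c1 := congrArg (fun f => Polynomial.coeff f 1) hp
        have c2 := congrArg (fun f => Polynomial.coeff f q) hp
        have c3 := congrArg (fun f => Polynomial.coeff f (q + 1)) hp
        simp [p, Polynomial.coeff_X, Polynomial.coeff_C, Polynomial.coeff_X_pow, show q ≠ 0 by omega, show q ≠ 1 by omega,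
          show 1 ≠ q by omega, show 0 ≠ q by omega] at c0 c1 c2 c3
        have hli : LinearIndependent (Kbar Fq) ![emb u, r, s] := by
          rw [Fintype.linearIndependent_iff]
          intro c hc
          simp [Fin.sum_univ_three] at hc
          have e1 := congrFun hc i
          have e2 := congrFun hc j
          simp [emb, hui, huj, hi, hsi] at e1 e2
          have e3 : c 1 = 0 := by
            have : c 1 * (r j - s j) = 0 := by linear_combination e2 - s j * e1
            simpa [hj'] using this
          have e4 : c 2 = 0 := by simpa [e3] using e1
          have e5 : c 0 = 0 := by
            rw [e3, e4] at hc
            simp at hc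
            refine hc.resolve_right fun h => hu0 (emb_inj (h.trans emb_zero.symm))
          intro k; fin_cases k <;> assumption
        refine no_plane hF hh hli fun a b c => ?_
        rw [ev_three hh b c a hr hs, c0, c1, c2, c3]
        ring
      have hdeg : p.natDegree ≤ q + 1 := by
        simp only [p]
        compute_degree
        all_goals omega
      have hinj : Set.InjOn α (A.filter fun x => g x = u) := by
        intro x hx y hy hxy
        have hx' := (Finset.mem_filter.1 hx).2
        have hy' := (Finset.mem_filter.1 hy).2
        apply emb_inj
        rw [hg x, hg y, hx', hy', hxy]
      rw [← Finset.card_image_of_injOn hinj]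
      have hsub : (A.filter fun x => g x = u).image α ⊆ p.roots.toFinset := by
        intro a ha
        obtain ⟨x, hx, rfl⟩ := Finset.mem_image.1 ha
        obtain ⟨hx1, hx2⟩ := Finset.mem_filter.1 hx
        have hx3 : eval (emb x) F = 0 := (Finset.mem_filter.1 hx1).2
        rw [Multiset.mem_toFinset, Polynomial.mem_roots hp]
        have := ev_three hh (α x) (frq Fq (α x)) 1 hr hs (emb u)
        rw [one_smul, ← hx2, ← hg x, hx3, hx2, frq_apply, ← hq] at this
        simp only [p, Polynomial.IsRoot, Polynomial.eval_add, Polynomial.eval_mul, Polynomial.eval_C, Polynomial.eval_X,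
          Polynomial.eval_pow]
        rw [pow_succ]
        linear_combination -this
      exact (Finset.card_le_card hsub).trans ((Multiset.toFinset_card_le _).trans
        ((Polynomial.card_roots' _).trans hdeg))
    · rw [smul_eq_mul, Finset.card_erase_of_mem h0V]
      exact Nat.mul_le_mul_right _ (Nat.sub_le_sub_right hV 1)

lemma bound_pair (F : MvPolynomial (Fin 4) (Kbar Fq)) (hF : Irreducible F) (hh : F.IsHomogeneous 3)
    (r s : Fin 4 → Kbar Fq) (hr : SingV F r) (hs : SingV F s) (hrs : frq Fq ∘ r = s) (hsr : frq Fq ∘ s = r)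
    (i j : Fin 4) (hi : r i = 1) (hj : r j ≠ s j) :
    Nat.card {p : P3 Fq // p ∈ projZeros F ∧ IsRatPoint (Fintype.card Fq) p} ≤
      Fintype.card Fq ^ 2 + 7 * Fintype.card Fq + 1 := by
  have h1 := proj_aff F hh
  have h2 := count_pair F hF hh r s hr hs hrs hsr i j hi hj
  have hq : 1 < Fintype.card Fq := Fintype.one_lt_card
  generalize Nat.card {p : P3 Fq // p ∈ projZeros F ∧ IsRatPoint (Fintype.card Fq) p} = N at *
  generalize Fintype.card Fq = q at *
  obtain ⟨k, rfl⟩ : ∃ k, q = k + 1 := ⟨q - 1, by omega⟩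
  have e : (k + 1) ^ 2 - 1 = k ^ 2 + 2 * k := by
    rw [show (k + 1) ^ 2 = k ^ 2 + 2 * k + 1 by ring]; rfl
  rw [e] at h2
  simp only [Nat.add_sub_cancel] at *
  have hk : 0 < k := by omega
  apply Nat.le_of_mul_le_mul_right _ hk
  nlinarith [h1.trans h2]

end PG

section PI

lemma li_of_ne {p p' : P3 Fq} (h : p ≠ p') : LinearIndependent (Kbar Fq) ![p.rep, p'.rep] := by
  rw [LinearIndependent.pair_iff' p.rep_nonzero]
  intro a ha
  apply h
  rw [← p.mk_rep, ← p'.mk_rep, eq_comm, Projectivization.mk_eq_mk_iff']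
  exact ⟨a, ha⟩

lemma sing_mk {F : MvPolynomial (Fin 4) (Kbar Fq)} (hh : F.IsHomogeneous 3) {v : Fin 4 → Kbar Fq} (hv : v ≠ 0)
    (h : SingV F v) : IsSingularAt F (Projectivization.mk (Kbar Fq) v hv) := by
  obtain ⟨a, ha⟩ := Projectivization.exists_smul_eq_mk_rep (Kbar Fq) v hv
  refine (singV_iff _ _).1 ?_
  rw [← ha, Units.smul_def]
  exact h.smul hh _

lemma map_frq {F : MvPolynomial (Fin 4) (Kbar Fq)}
    (hc : ∀ m, coeff m F ^ Fintype.card Fq = coeff m F) : map (frq Fq) F = F := by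
  ext m
  rw [coeff_map, frq_apply, hc]

lemma bound_rat {F : MvPolynomial (Fin 4) (Kbar Fq)} (hF : Irreducible F) (hh : F.IsHomogeneous 3)
    {s : Fin 4 → Kbar Fq} (hs0 : s ≠ 0) (hs : SingV F s) (hφ : frq Fq ∘ s = s) (hd : ∃ w, dd F w s ≠ 0) :
    Nat.card {p : P3 Fq // p ∈ projZeros F ∧ IsRatPoint (Fintype.card Fq) p} ≤
      Fintype.card Fq ^ 2 + 7 * Fintype.card Fq + 1 := by
  obtain ⟨x, rfl⟩ := exists_emb (y := s) (fun i => congrFun hφ i)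
  exact bound_double F hF hh x (fun h => hs0 (by rw [h, emb_zero])) hs hd

lemma bound_line {F : MvPolynomial (Fin 4) (Kbar Fq)} (hF : Irreducible F) (hh : F.IsHomogeneous 3)
    (hφ : map (frq Fq) F = F) {v₁ v₂ : Fin 4 → Kbar Fq} (hl : LinearIndependent (Kbar Fq) ![v₁, v₂])
    (h : ∀ a b : Kbar Fq, SingV F (a • v₁ + b • v₂)) :
    Nat.card {p : P3 Fq // p ∈ projZeros F ∧ IsRatPoint (Fintype.card Fq) p} ≤
      Fintype.card Fq ^ 2 + 7 * Fintype.card Fq + 1 := by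
  obtain ⟨s, hs0, hs, hsφ, hd⟩ := rational_double_of_line (frq Fq) hφ hF hh hl h
  exact bound_rat hF hh hs0 hs hsφ hd

lemma bound_ratsing {F : MvPolynomial (Fin 4) (Kbar Fq)} (hF : Irreducible F) (hh : F.IsHomogeneous 3)
    (hφ : map (frq Fq) F = F) (hnc : ¬ IsConeOverSmoothCubic F)
    {s : Fin 4 → Kbar Fq} (hs0 : s ≠ 0) (hs : SingV F s) (hsφ : frq Fq ∘ s = s) :
    Nat.card {p : P3 Fq // p ∈ projZeros F ∧ IsRatPoint (Fintype.card Fq) p} ≤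
      Fintype.card Fq ^ 2 + 7 * Fintype.card Fq + 1 := by
  by_cases hd : ∃ w, dd F w s ≠ 0
  · exact bound_rat hF hh hs0 hs hsφ hd
  · push Not at hd
    obtain ⟨t, ht, hl⟩ := cone_sing F hF hh hnc hs0 ⟨hs, hd⟩
    exact bound_line hF hh hφ hl (line_of_trip hh ⟨hs, hd⟩ ht)

lemma bound_inf {F : MvPolynomial (Fin 4) (Kbar Fq)} (hF : Irreducible F) (hh : F.IsHomogeneous 3)
    (hφ : map (frq Fq) F = F) (hinf : {p : P3 Fq | IsSingularAt F p}.Infinite) :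
    Nat.card {p : P3 Fq // p ∈ projZeros F ∧ IsRatPoint (Fintype.card Fq) p} ≤
      Fintype.card Fq ^ 2 + 7 * Fintype.card Fq + 1 := by
  obtain ⟨p, hp⟩ := hinf.nonempty
  have hinf' := hinf.diff (Set.finite_singleton p)
  let e := hinf'.natEmbedding
  have hv : SingV F p.rep := (singV_iff _ _).2 hp
  have he : ∀ n, SingV F (e n).1.rep := fun n => (singV_iff _ _).2 (e n).2.1
  have hne : ∀ n, p ≠ (e n).1 := fun n h => (e n).2.2 h.symm
  by_cases hd : ∃ w, dd F w p.rep ≠ 0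
  · obtain ⟨i, j, hij, hli⟩ := double_pt hF hh p.rep_nonzero hv hd (fun j : Fin 7 => (e j).1.rep)
      (fun j => ⟨(he j).1, (he j).2 _⟩)
    have hij' : (e i).1 ≠ (e j).1 := by
      intro h
      apply hij
      have := e.injective (Subtype.ext h)
      exact Fin.ext this
    have l1 := LinearIndependent.pair_iff.1 (li_of_ne (hne i))
    have l2 := LinearIndependent.pair_iff.1 (li_of_ne (hne j))
    have l3 := LinearIndependent.pair_iff.1 (li_of_ne hij')
    obtain ⟨g, hg, k, hk⟩ := Fintype.not_linearIndependent_iff.1 hli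
    simp [Fin.sum_univ_three] at hg
    have hk' : ¬ (g 0 = 0 ∧ g 1 = 0 ∧ g 2 = 0) := by
      rintro ⟨h0, h1, h2⟩
      apply hk
      fin_cases k <;> assumption
    have hg0 : g 0 ≠ 0 := by
      intro h0
      rw [h0, zero_smul, zero_add] at hg
      exact hk' ⟨h0, l3 _ _ hg⟩
    have hg1 : g 1 ≠ 0 := by
      intro h0
      rw [h0, zero_smul, add_zero] at hg
      exact hk' ⟨(l2 _ _ hg).1, h0, (l2 _ _ hg).2⟩
    refine bound_line hF hh hφ (li_of_ne (hne i)) (line_of_three hh hv (he i) hg0 hg1 ?_)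
    have : g 0 • p.rep + g 1 • (e i).1.rep = (- g 2) • (e j).1.rep := by
      rw [neg_smul]; exact eq_neg_of_add_eq_zero_left hg
    rw [this]
    exact (he j).smul hh _
  · push Not at hd
    exact bound_line hF hh hφ (li_of_ne (hne 0)) (line_of_trip hh ⟨hv, hd⟩ (he 0))

lemma norm_mk (p : P3 Fq) : ∃ (r : Fin 4 → Kbar Fq) (i : Fin 4) (h : r ≠ 0), r i = 1 ∧
    Projectivization.mk (Kbar Fq) r h = p := by
  obtain ⟨i, hi⟩ := Function.ne_iff.1 p.rep_nonzero
  simp only [Pi.zero_apply] at hi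
  have h1 : ((p.rep i)⁻¹ • p.rep) i = 1 := by simp [hi]
  refine ⟨(p.rep i)⁻¹ • p.rep, i, fun h => by rw [h] at h1; simp at h1, h1, ?_⟩
  conv_rhs => rw [← p.mk_rep]
  rw [Projectivization.mk_eq_mk_iff']
  exact ⟨_, rfl⟩

lemma eq_of_mk {r s : Fin 4 → Kbar Fq} (hr : r ≠ 0) (hs : s ≠ 0) (i : Fin 4) (hi : r i = 1) (hi' : s i = 1)
    (h : Projectivization.mk (Kbar Fq) r hr = Projectivization.mk (Kbar Fq) s hs) : r = s := by
  rw [Projectivization.mk_eq_mk_iff'] at h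
  obtain ⟨a, ha⟩ := h
  have := congrFun ha i
  simp [hi, hi'] at this
  rw [← ha, this, one_smul]

lemma bound_two {F : MvPolynomial (Fin 4) (Kbar Fq)} (hF : Irreducible F) (hh : F.IsHomogeneous 3)
    (hφ : map (frq Fq) F = F) (hnc : ¬ IsConeOverSmoothCubic F) {p₁ p₂ : P3 Fq}
    (hS : {p : P3 Fq | IsSingularAt F p} = {p₁, p₂}) :
    Nat.card {p : P3 Fq // p ∈ projZeros F ∧ IsRatPoint (Fintype.card Fq) p} ≤
      Fintype.card Fq ^ 2 + 7 * Fintype.card Fq + 1 := by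
  obtain ⟨r, i, hr0, hri, hrp⟩ := norm_mk p₁
  have hmem : ∀ p, IsSingularAt F p → p = p₁ ∨ p = p₂ := by
    intro p hp
    have : p ∈ ({p₁, p₂} : Set (P3 Fq)) := hS ▸ hp
    simpa using this
  have hp1 : IsSingularAt F p₁ := by
    have : p₁ ∈ {p : P3 Fq | IsSingularAt F p} := by rw [hS]; simp
    exact this
  have hr : SingV F r := by
    obtain ⟨a, ha⟩ := Projectivization.exists_smul_eq_mk_rep (Kbar Fq) r hr0
    have h1 : SingV F p₁.rep := (singV_iff _ _).2 hp1
    rw [← hrp, ← ha, Units.smul_def] at h1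
    have := h1.smul hh (a : Kbar Fq)⁻¹
    rwa [smul_smul, inv_mul_cancel₀ a.ne_zero, one_smul] at this
  let s := frq Fq ∘ r
  let t := frq Fq ∘ s
  have hsi : s i = 1 := by simp [s, hri]
  have hti : t i = 1 := by simp [t, hsi]
  have hs0 : s ≠ 0 := fun h => by simp [h] at hsi
  have ht0 : t ≠ 0 := fun h => by simp [h] at hti
  have hs : SingV F s := sing_frob _ hφ hr
  have ht : SingV F t := sing_frob _ hφ hs
  by_cases hsr : s = r
  · exact bound_ratsing hF hh hφ hnc hr0 hr hsr
  have hts : t ≠ s := by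
    intro h
    apply hsr
    ext k
    exact (frq Fq).injective (congrFun h k)
  have hs1 : Projectivization.mk (Kbar Fq) s hs0 = p₂ := by
    refine (hmem _ (sing_mk hh hs0 hs)).resolve_left fun h => hsr ?_
    exact eq_of_mk hs0 hr0 i hsi hri (h.trans hrp.symm)
  have ht1 : Projectivization.mk (Kbar Fq) t ht0 = p₁ := by
    refine (hmem _ (sing_mk hh ht0 ht)).resolve_right fun h => hts ?_
    exact eq_of_mk ht0 hs0 i hti hsi (h.trans hs1.symm)
  have htr : t = r := eq_of_mk ht0 hr0 i hti hri (ht1.trans hrp.symm)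
  obtain ⟨j, hj⟩ := Function.ne_iff.1 hsr
  exact bound_pair F hF hh r s hr hs rfl htr i j hri (Ne.symm hj)

end PI

/-- An absolutely irreducible cubic surface over `F_q` which is not a cone
over a smooth absolutely irreducible plane cubic, and which either has non-isolated
singularities, or has finitely many singular points one of which is `F_q`-rational, or has
exactly two singular points, has at most `q^2 + 7q + 1` points over `F_q`. -/
theorem statement_0 (q : ℕ) (hq : q = Fintype.card Fq)
    (F : MvPolynomial (Fin 4) (Kbar Fq)) (hF0 : F ≠ 0) (hhom : F.IsHomogeneous 3)
    (hcoeff : ∀ m, coeff m F ^ q = coeff m F)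
    (hirr : Irreducible F)
    (hnotcone : ¬ IsConeOverSmoothCubic F)
    (hcases :
      {p : P3 Fq | IsSingularAt F p}.Infinite ∨
      ({p : P3 Fq | IsSingularAt F p}.Finite ∧
        ∃ p : P3 Fq, IsSingularAt F p ∧ IsRatPoint q p) ∨
      (∃ p₁ p₂ : P3 Fq, p₁ ≠ p₂ ∧ {p : P3 Fq | IsSingularAt F p} = {p₁, p₂})) :
    Nat.card {p : P3 Fq // p ∈ projZeros F ∧ IsRatPoint q p} ≤ q ^ 2 + 7 * q + 1 := by
  subst hq
  have hφ := map_frq hcoeff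
  rcases hcases with h | ⟨-, p, hp, v, hv, hvp, hr⟩ | ⟨p₁, p₂, -, hS⟩
  · exact bound_inf hirr hhom hφ h
  · have hs : SingV F v := by
      obtain ⟨a, ha⟩ := Projectivization.exists_smul_eq_mk_rep (Kbar Fq) v hv
      have h1 : SingV F p.rep := (singV_iff _ _).2 hp
      rw [← hvp, ← ha, Units.smul_def] at h1
      have := h1.smul hhom (a : Kbar Fq)⁻¹
      rwa [smul_smul, inv_mul_cancel₀ a.ne_zero, one_smul] at this
    exact bound_ratsing hirr hhom hφ hnotcone hv hs (funext hr)
  · exact bound_two hirr hhom hφ hnotcone hS
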